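/- arXiv:1801.06078 — 2 statements merged into one kernel-verified Lean document; each statement's English description precedes it below -/
import Mathlib

section
/- Let c be a standard Coxeter element of a finite Coxeter system (W,S) and let v, w ∈ NC(W,c) with v ⋖ w a cover in absolute order (so vw⁻¹ ∈ T and ℓ_T(v) = ℓ_T(w) − 1). If v >_B w in Bruhat order, then K(v) >_B K(w), where K(u) = u⁻¹c is the Kreweras complement. -/
namespace NCpaper

open CoxeterSystem

variable {B : Type*} {W : Type*} [Group W] {M : CoxeterMatrix B}

/-- The absolute length: minimal length of a factorization into reflections. -/
noncomputable def absLength (cs : CoxeterSystem M W) (w : W) : ℕ :=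
  sInf {k | ∃ l : List W, (∀ t ∈ l, cs.IsReflection t) ∧ l.length = k ∧ l.prod = w}

/-- The absolute order: `v ≤ w` iff `ℓ_T w = ℓ_T (v⁻¹ w) + ℓ_T v`. -/
noncomputable def AbsLe (cs : CoxeterSystem M W) (v w : W) : Prop :=
  absLength cs w = absLength cs (v⁻¹ * w) + absLength cs v

/-- Cover relation of the absolute order. -/
noncomputable def AbsCovBy (cs : CoxeterSystem M W) (v w : W) : Prop :=
  cs.IsReflection (v⁻¹ * w) ∧ absLength cs w = absLength cs v + 1

/-- Generating relation of the Bruhat order: multiply by a reflection, length goes up. -/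
def BruhatGen (cs : CoxeterSystem M W) (v w : W) : Prop :=
  cs.IsReflection (v⁻¹ * w) ∧ cs.length v < cs.length w

/-- The Bruhat order. -/
def BruhatLe (cs : CoxeterSystem M W) : W → W → Prop := Relation.ReflTransGen (BruhatGen cs)

/-- The strict Bruhat order. -/
def BruhatLt (cs : CoxeterSystem M W) : W → W → Prop := Relation.TransGen (BruhatGen cs)

/-- The support of an element: simple reflections occurring in every (equivalently, some)
reduced word for it. -/
def supp (cs : CoxeterSystem M W) (w : W) : Set B :=
  {i | ∀ l : List B, cs.IsReduced l → cs.wordProd l = w → i ∈ l}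

/-- A standard Coxeter element: the product of all the simple reflections, each once,
in some order. -/
def IsStdCoxeterElement (cs : CoxeterSystem M W) (c : W) : Prop :=
  ∃ l : List B, l.Nodup ∧ (∀ i : B, i ∈ l) ∧ cs.wordProd l = c

/-- Generating relation for the order `⊏`: an absolute-order cover which is Bruhat-increasing. -/
noncomputable def SqGen (cs : CoxeterSystem M W) (v w : W) : Prop :=
  AbsCovBy cs v w ∧ BruhatLt cs v w

/-- The order `⊏`. -/
noncomputable def Sq (cs : CoxeterSystem M W) : W → W → Prop :=
  Relation.ReflTransGen (SqGen cs)

/-- Generating relation for the order `≪`: an absolute-order cover which is Bruhat-decreasing. -/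
noncomputable def LlGen (cs : CoxeterSystem M W) (v w : W) : Prop :=
  AbsCovBy cs v w ∧ BruhatLt cs w v

/-- The order `≪`. -/
noncomputable def Ll (cs : CoxeterSystem M W) : W → W → Prop :=
  Relation.ReflTransGen (LlGen cs)


section Geom

set_option linter.unusedSectionVars false
set_option linter.unusedSimpArgs false

open CoxeterSystem Polynomial

variable {B : Type*} {W : Type*} [Group W] (M : CoxeterMatrix B) [Fintype B] [DecidableEq B]

/-- The Coxeter bilinear form. -/
noncomputable def bf : LinearMap.BilinForm ℝ (B → ℝ) :=
  Matrix.toBilin' (Matrix.of fun i j => -Real.cos (Real.pi / (M i j : ℝ)))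

/-- Simple root. -/
def sr (i : B) : B → ℝ := Pi.single i 1

theorem sr_self (i : B) : sr i i = 1 := by simp [sr]

theorem sr_ne {i j : B} (h : j ≠ i) : sr i j = 0 := by simp [sr, h]

theorem sr_nonneg (i : B) : 0 ≤ sr i := by
  intro j
  by_cases h : j = i
  · subst h; rw [sr_self]; simp
  · rw [sr_ne h]; simp

theorem bf_sr (i j : B) : bf M (sr i) (sr j) = -Real.cos (Real.pi / (M i j : ℝ)) := by
  simp [bf, sr, Matrix.toBilin'_single]

theorem bf_symm (x y : B → ℝ) : bf M x y = bf M y x := by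
  simp only [bf, Matrix.toBilin'_apply, Matrix.of_apply]
  rw [Finset.sum_comm]
  refine Finset.sum_congr rfl fun i _ => Finset.sum_congr rfl fun j _ => ?_
  rw [M.symmetric i j]; ring

theorem bf_self (i : B) : bf M (sr i) (sr i) = 1 := by
  simp [bf_sr]

theorem two_bf_self (i : B) : ((2 : ℝ) • bf M (sr i)) (sr i) = 2 := by
  simp [bf_self]

/-- Simple reflection on V. -/
noncomputable def srefl (i : B) : (B → ℝ) ≃ₗ[ℝ] (B → ℝ) :=
  Module.reflection (two_bf_self M i)

theorem srefl_apply (i : B) (x : B → ℝ) :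
    srefl M i x = x - (2 * bf M (sr i) x) • sr i := by
  simp [srefl, Module.reflection_apply]

theorem srefl_sq (i : B) : srefl M i * srefl M i = 1 := by
  ext1 x
  exact Module.involutive_reflection (two_bf_self M i) x

theorem S_eval_sin (φ : ℝ) (n : ℤ) :
    (Chebyshev.S ℝ n).eval (2 * Real.cos φ) * Real.sin φ = Real.sin ((n + 1) * φ) := by
  induction n using Polynomial.Chebyshev.induct with
  | zero => simp
  | one => simp [show ((1:ℝ) + 1) * φ = 2 * φ by ring, Real.sin_two_mul]; ring
  | add_two n h1 h2 =>
    have e : ((((n : ℤ) + 2 : ℤ) : ℝ) + 1) * φ = ((n : ℝ) + 2) * φ + φ := by push_cast; ring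
    have e2 : (((n : ℤ) : ℝ) + 1) * φ = ((n : ℝ) + 2) * φ - φ := by push_cast; ring
    have e3 : ((((n : ℤ) + 1 : ℤ) : ℝ) + 1) * φ = ((n : ℝ) + 2) * φ := by push_cast; ring
    rw [e3] at h1
    rw [e2] at h2
    rw [e, Chebyshev.S_add_two, eval_sub, eval_mul, eval_X, sub_mul, mul_assoc, h1, h2]
    rw [Real.sin_add, Real.sin_sub]; ring
  | neg_add_one n h1 h2 =>
    have e : (((-(n : ℤ) - 1 : ℤ) : ℝ) + 1) * φ = (-(n : ℝ) + 1) * φ - φ := by push_cast; ring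
    have e2 : (((-(n : ℤ) + 1 : ℤ) : ℝ) + 1) * φ = (-(n : ℝ) + 1) * φ + φ := by push_cast; ring
    have e3 : (((-(n : ℤ) : ℤ) : ℝ) + 1) * φ = (-(n : ℝ) + 1) * φ := by push_cast; ring
    rw [e3] at h1
    rw [e2] at h2
    rw [e, Chebyshev.S_sub_one, eval_sub, eval_mul, eval_X, sub_mul, mul_assoc, h1, h2]
    rw [Real.sin_add, Real.sin_sub]; ring

theorem srefl_liftable : M.IsLiftable (srefl M) := by
  intro i j
  by_cases hij : i = j
  · subst hij; simp [srefl_sq]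
  have hM1 := M.off_diagonal i j hij
  by_cases hM0 : M i j = 0
  · simp [hM0]
  by_cases hM2 : M i j = 2
  · have h0 : bf M (sr i) (sr j) = 0 := by rw [bf_sr, hM2]; simp
    have h0' : bf M (sr j) (sr i) = 0 := by rw [bf_symm, h0]
    rw [hM2]
    ext1 x
    rw [pow_two]
    simp only [LinearEquiv.mul_apply, srefl_apply, map_sub, map_smul, h0, h0', bf_self,
      LinearEquiv.coe_one, id, smul_eq_mul]
    module
  have hm : 3 ≤ M i j := by omega
  set m := M i j with hmdef
  have hmr : (3 : ℝ) ≤ m := by exact_mod_cast hm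
  set φ : ℝ := 2 * (Real.pi / m) with hφ
  have hmφ : (m : ℝ) * φ = 2 * Real.pi := by rw [hφ]; field_simp
  have hs : 0 < Real.sin φ := by
    apply Real.sin_pos_of_pos_of_lt_pi
    · have := Real.pi_pos; positivity
    · have := Real.pi_pos
      nlinarith
  have ht : 2 * Real.cos φ = ((2 : ℝ) • bf M (sr i)) (sr j) * ((2 : ℝ) • bf M (sr j)) (sr i) - 2 := by
    simp only [LinearMap.smul_apply, smul_eq_mul]
    rw [bf_symm M (sr j), bf_sr, hφ, Real.cos_two_mul]; ring
  have key := fun z => Module.reflection_mul_reflection_pow_apply (two_bf_self M i)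
    (two_bf_self M j) m z (2 * Real.cos φ) ht
  have hS : ∀ n k : ℤ, (n + k + 2 = m) → (Chebyshev.S ℝ n).eval (2 * Real.cos φ)
      + (Chebyshev.S ℝ k).eval (2 * Real.cos φ) = 0 := by
    intro n k h
    have h1 := S_eval_sin φ n
    have h2 := S_eval_sin φ k
    have e : ((n : ℝ) + 1) * φ = 2 * Real.pi - (k + 1) * φ := by
      rw [← hmφ]
      have : (n : ℝ) + k + 2 = m := by exact_mod_cast h
      rw [← this]; ring
    rw [e, Real.sin_two_pi_sub] at h1
    have : ((Chebyshev.S ℝ n).eval (2 * Real.cos φ)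
      + (Chebyshev.S ℝ k).eval (2 * Real.cos φ)) * Real.sin φ = 0 := by
      rw [add_mul, h1, h2]; ring
    exact (mul_eq_zero.mp this).resolve_right hs.ne'
  ext1 z
  have h := key z
  rcases Nat.even_or_odd' m with ⟨k, hk | hk⟩
  · have c1 : ((m : ℤ) - 2) / 2 = k - 1 := by omega
    have c2 : ((m : ℤ) - 1) / 2 = k - 1 := by omega
    have z0 := hS (k - 1) (k - 1) (by omega)
    have z1 : (Chebyshev.S ℝ ((k : ℤ) - 1)).eval (2 * Real.cos φ) = 0 := by linarith
    rw [c1, c2, z1] at h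
    simp only [zero_mul, mul_zero, zero_smul, add_zero] at h
    exact h
  · have c1 : ((m : ℤ) - 2) / 2 = k - 1 := by omega
    have c2 : ((m : ℤ) - 1) / 2 = k := by omega
    have c3 : ((m : ℤ) - 3) / 2 = k - 1 := by omega
    have c4 : ((m : ℤ)) / 2 = k := by omega
    have z0 := hS k (k - 1) (by omega)
    rw [c1, c2, c3, c4, z0] at h
    simp only [zero_mul, mul_zero, zero_smul, add_zero] at h
    exact h

variable {M} (cs : CoxeterSystem M W)

/-- The geometric representation. -/
noncomputable def rep : W →* ((B → ℝ) ≃ₗ[ℝ] (B → ℝ)) :=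
  cs.lift ⟨srefl M, srefl_liftable M⟩

theorem rep_simple (i : B) : rep cs (cs.simple i) = srefl M i :=
  cs.lift_apply_simple _ _

theorem rep_simple_apply (i : B) (x : B → ℝ) :
    rep cs (cs.simple i) x = x - (2 * bf M (sr i) x) • sr i := by
  rw [rep_simple, srefl_apply]

theorem rep_simple_self (i : B) : rep cs (cs.simple i) (sr i) = - sr i := by
  rw [rep_simple_apply, bf_self]; module

theorem rep_simple_coord {i j : B} (h : j ≠ i) (x : B → ℝ) :
    rep cs (cs.simple i) x j = x j := by
  rw [rep_simple_apply]; simp [sr_ne h]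

theorem rep_mul (v w : W) (x : B → ℝ) : rep cs (v * w) x = rep cs v (rep cs w x) := by
  rw [map_mul]; rfl

theorem rep_one (x : B → ℝ) : rep cs 1 x = x := by
  rw [map_one]; rfl

theorem rep_inv_rep (v : W) (x : B → ℝ) : rep cs v⁻¹ (rep cs v x) = x := by
  rw [← rep_mul, inv_mul_cancel, rep_one]

theorem rep_rep_inv (v : W) (x : B → ℝ) : rep cs v (rep cs v⁻¹ x) = x := by
  rw [← rep_mul, mul_inv_cancel, rep_one]

theorem bf_rep (w : W) (x y : B → ℝ) : bf M (rep cs w x) (rep cs w y) = bf M x y := by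
  induction w using cs.simple_induction_left generalizing x y with
  | one => simp [rep_one]
  | mul_simple_left w i ih =>
    rw [rep_mul, rep_mul, ← ih x y, rep_simple_apply, rep_simple_apply]
    simp only [map_sub, map_smul, LinearMap.sub_apply, LinearMap.smul_apply, bf_self, smul_eq_mul]
    rw [bf_symm M _ (sr i)]; ring

theorem rep_conj (w : W) (i : B) (x : B → ℝ) :
    rep cs (w * cs.simple i * w⁻¹) x
      = x - (2 * bf M (rep cs w (sr i)) x) • rep cs w (sr i) := by
  rw [rep_mul, rep_mul, rep_simple_apply, map_sub, map_smul, rep_rep_inv]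
  congr 3
  rw [← bf_rep cs w, rep_rep_inv]

/-- Numbers in the dihedral computation. -/
theorem exists_dihedral_seq (i j : B) (hij : i ≠ j) : ∃ a : ℕ → ℝ, a 0 = 0 ∧ a 1 = 1 ∧
    (∀ k, a (k + 2) = 2 * Real.cos (Real.pi / (M i j : ℝ)) * a (k + 1) - a k) ∧
    ∀ k, (M i j ≠ 0 → k ≤ M i j) → 0 ≤ a k := by
  have hM1 := M.off_diagonal i j hij
  by_cases hM0 : M i j = 0
  · refine ⟨fun k => k, by simp, by simp, fun k => ?_, fun k _ => by positivity⟩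
    rw [hM0]; simp; ring
  have hm : 2 ≤ M i j := by omega
  set m := M i j with hmdef
  have hmr : (2 : ℝ) ≤ m := by exact_mod_cast hm
  have hpi := Real.pi_pos
  have hmθ : (m : ℝ) * (Real.pi / m) = Real.pi := by field_simp
  set θ := Real.pi / (m : ℝ) with hθ
  have hθ0 : 0 < θ := by positivity
  have hs : 0 < Real.sin θ := by
    apply Real.sin_pos_of_pos_of_lt_pi hθ0
    nlinarith
  refine ⟨fun k => Real.sin (k * θ) / Real.sin θ, by simp, by simp [hs.ne'], fun k => ?_,
    fun k hk => ?_⟩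
  · have e : ((k + 2 : ℕ) : ℝ) * θ = (k + 1) * θ + θ := by push_cast; ring
    have e2 : (k : ℝ) * θ = (k + 1) * θ - θ := by ring
    simp only []
    rw [e, e2, Real.sin_add, Real.sin_sub]
    push_cast
    field_simp
    ring
  · apply div_nonneg _ hs.le
    apply Real.sin_nonneg_of_nonneg_of_le_pi (by positivity)
    have : (k : ℝ) ≤ m := by exact_mod_cast hk hM0
    nlinarith

end Geom

section Pos

set_option linter.unusedSectionVars false
set_option linter.unusedSimpArgs false

open CoxeterSystem

variable {B : Type*} {W : Type*} [Group W] {M : CoxeterMatrix B} [Fintype B] [DecidableEq B]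
variable (cs : CoxeterSystem M W)

theorem rep_alternating (i j : B) (a : ℕ → ℝ) (h0 : a 0 = 0) (h1 : a 1 = 1)
    (hrec : ∀ k, a (k + 2) = 2 * Real.cos (Real.pi / (M i j : ℝ)) * a (k + 1) - a k) (k : ℕ) :
    rep cs (cs.wordProd (alternatingWord i j k)) (sr i)
      = a (k + 1) • sr (if Even (k + 1) then j else i) + a k • sr (if Even k then j else i) := by
  induction k with
  | zero => simp [alternatingWord, h0, h1]
  | succ k ih =>
    rw [alternatingWord_succ', wordProd_cons, rep_mul, ih, rep_simple_apply]
    have hs : bf M (sr j) (sr i) = bf M (sr i) (sr j) := bf_symm M _ _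
    by_cases hk : Even k
    · have hk1 : ¬ Even (k + 1) := by simpa [Nat.even_add_one] using hk
      have hk2 : Even (k + 1 + 1) := by simpa [Nat.even_add_one] using hk
      simp only [hk, hk1, hk2, if_true, if_false, map_add, map_smul, smul_eq_mul, bf_self, hs, bf_sr,
        hrec]
      module
    · have hk1 : Even (k + 1) := by simpa [Nat.even_add_one] using hk
      have hk2 : ¬ Even (k + 1 + 1) := by simpa [Nat.even_add_one] using hk
      simp only [hk, hk1, hk2, if_true, if_false, map_add, map_smul, smul_eq_mul, bf_self, hs, bf_sr,
        hrec]
      module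

theorem rep_pos_of_lt (n : ℕ) : ∀ (w : W), cs.length w = n → ∀ i : B,
    cs.length w < cs.length (w * cs.simple i) → 0 ≤ rep cs w (sr i) := by
  classical
  induction n using Nat.strong_induction_on with
  | _ n IH =>
  intro w hw i hi
  by_cases hw1 : w = 1
  · subst hw1; rw [rep_one]; exact sr_nonneg i
  obtain ⟨j, hj⟩ := cs.exists_rightDescent_of_ne_one hw1
  have hij : i ≠ j := by
    rintro rfl
    unfold IsRightDescent at hj; omega
  obtain ⟨a, h0, h1, hrec, hnn⟩ := exists_dihedral_seq (M := M) i j hij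
  let P : ℕ → Prop := fun k => ∃ v, w = v * cs.wordProd (alternatingWord i j k) ∧
    cs.length v + k = cs.length w
  have hPdown : ∀ k, P (k + 1) → P k := by
    rintro k ⟨v, hv, hl⟩
    rw [alternatingWord_succ', wordProd_cons, ← mul_assoc] at hv
    refine ⟨_, hv, ?_⟩
    have e1 := cs.length_mul_le v (cs.simple (if Even k then j else i))
    rw [length_simple] at e1
    have e2 := cs.length_mul_le (v * cs.simple (if Even k then j else i))
      (cs.wordProd (alternatingWord i j k))
    rw [← hv] at e2
    have e3 := cs.length_wordProd_le (alternatingWord i j k)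
    rw [length_alternatingWord] at e3
    omega
  have hPdown' : ∀ d k, P (k + d) → P k := by
    intro d
    induction d with
    | zero => exact fun k h => h
    | succ d ih => exact fun k h => ih k (hPdown _ h)
  have hP1 : P 1 := by
    refine ⟨w * cs.simple j, ?_, ?_⟩
    · simp [alternatingWord]
    · exact cs.isRightDescent_iff.mp hj
  have hn1 : 1 ≤ n := by
    obtain ⟨v, _, h⟩ := hP1
    omega
  obtain ⟨v, hv, hl⟩ : P (Nat.findGreatest P n) := Nat.findGreatest_spec hn1 hP1
  have hk1 : 1 ≤ Nat.findGreatest P n := Nat.le_findGreatest hn1 hP1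
  have hmax : ¬ P (Nat.findGreatest P n + 1) := by
    intro h
    by_cases hle : Nat.findGreatest P n + 1 ≤ n
    · exact absurd (Nat.le_findGreatest hle h) (by omega)
    · obtain ⟨v, _, h⟩ := h
      omega
  generalize Nat.findGreatest P n = k at hv hl hk1 hmax
  have hkm : M i j ≠ 0 → k < M i j := by
    intro hM0
    by_contra hlt
    push Not at hlt
    obtain ⟨d, hd⟩ := Nat.exists_eq_add_of_le hlt
    obtain ⟨u, hu, hul⟩ : P (M i j) := hPdown' d _ (hd ▸ ⟨v, hv, hl⟩)
    have hb := cs.wordProd_braidWord_eq i j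
    unfold braidWord at hb
    rw [hb, M.symmetric j i] at hu
    obtain ⟨m, hm⟩ := Nat.exists_eq_succ_of_ne_zero hM0
    rw [hm, Nat.succ_eq_add_one, alternatingWord_succ, wordProd_concat, ← mul_assoc] at hu
    have : w * cs.simple i = u * cs.wordProd (alternatingWord i j m) := by
      rw [hu]; simp
    rw [this] at hi
    have e2 := cs.length_mul_le u (cs.wordProd (alternatingWord i j m))
    have e3 := cs.length_wordProd_le (alternatingWord i j m)
    rw [length_alternatingWord] at e3
    omega
  have hvb : cs.length v < cs.length (v * cs.simple (if Even k then j else i)) := by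
    rcases cs.length_mul_simple v (if Even k then j else i) with h | h
    · omega
    · exfalso
      apply hmax
      refine ⟨v * cs.simple (if Even k then j else i), ?_, by omega⟩
      rw [alternatingWord_succ', wordProd_cons]
      simpa [mul_assoc] using hv
  have hva : cs.length v < cs.length (v * cs.simple (if Even (k + 1) then j else i)) := by
    rcases cs.length_mul_simple v (if Even (k + 1) then j else i) with h | h
    · omega
    · exfalso
      obtain ⟨m, hm⟩ := Nat.exists_eq_succ_of_ne_zero (show k ≠ 0 by omega)
      subst hm
      have hpar : (if Even (m.succ + 1) then j else i) = (if Even m then j else i) := by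
        simp [Nat.even_add_one, Nat.succ_eq_add_one]
      rw [hpar] at h
      rw [Nat.succ_eq_add_one, alternatingWord_succ', wordProd_cons, ← mul_assoc] at hv
      have e2 := cs.length_mul_le (v * cs.simple (if Even m then j else i))
        (cs.wordProd (alternatingWord i j m))
      rw [← hv] at e2
      have e3 := cs.length_wordProd_le (alternatingWord i j m)
      rw [length_alternatingWord] at e3
      omega
  have p1 := IH (cs.length v) (by omega) v rfl _ hva
  have p2 := IH (cs.length v) (by omega) v rfl _ hvb
  rw [hv, rep_mul, rep_alternating cs i j a h0 h1 hrec, map_add, map_smul, map_smul]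
  have n1 := hnn (k + 1) (fun h => hkm h)
  have n2 := hnn k (fun h => (hkm h).le)
  exact add_nonneg (smul_nonneg n1 p1) (smul_nonneg n2 p2)

theorem rep_pos {w : W} {i : B} (h : cs.length w < cs.length (w * cs.simple i)) :
    0 ≤ rep cs w (sr i) := rep_pos_of_lt cs _ w rfl i h

theorem rep_neg {w : W} {i : B} (h : cs.length (w * cs.simple i) < cs.length w) :
    rep cs w (sr i) ≤ 0 := by
  have := rep_pos cs (w := w * cs.simple i) (i := i) (by simpa using h)
  rw [rep_mul, rep_simple_self, map_neg] at this
  simpa using this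

theorem rep_pos_or_neg (w : W) (i : B) : 0 ≤ rep cs w (sr i) ∨ rep cs w (sr i) ≤ 0 := by
  rcases (cs.length_mul_simple_ne w i).lt_or_gt with h | h
  · exact Or.inr (rep_neg cs h)
  · exact Or.inl (rep_pos cs h)

theorem sr_ne_zero (i : B) : sr i ≠ 0 := by
  intro h
  have := sr_self i
  rw [h] at this
  simp at this

theorem rep_faithful {v w : W} (h : ∀ x, rep cs v x = rep cs w x) : v = w := by
  by_contra hne
  have hu : w⁻¹ * v ≠ 1 := by
    intro h1; exact hne (inv_mul_eq_one.mp h1).symm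
  obtain ⟨i, hi⟩ := cs.exists_rightDescent_of_ne_one hu
  have := rep_neg cs hi
  rw [rep_mul, h, rep_inv_rep] at this
  exact sr_ne_zero i (le_antisymm this (sr_nonneg i))

theorem conj_eq_of_root_eq {x y : W} {i j : B} (h : rep cs x (sr i) = rep cs y (sr j)) :
    x * cs.simple i * x⁻¹ = y * cs.simple j * y⁻¹ := by
  apply rep_faithful cs
  intro z
  rw [rep_conj, rep_conj, h]

/-- Exchange: if a positive root becomes negative along a word. -/
theorem exchange (l : List B) (x : W) (i : B) (hpos : 0 ≤ rep cs x (sr i))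
    (hneg : rep cs (cs.wordProd l)⁻¹ (rep cs x (sr i)) ≤ 0) :
    ∃ l₁ j l₂, l = l₁ ++ j :: l₂ ∧ rep cs x (sr i) = rep cs (cs.wordProd l₁) (sr j) := by
  induction l generalizing x with
  | nil =>
    exfalso
    simp only [wordProd_nil, inv_one, rep_one] at hneg
    have h0 := le_antisymm hneg hpos
    have := rep_inv_rep cs x (sr i)
    rw [h0, map_zero] at this
    exact sr_ne_zero i this.symm
  | cons k l ih =>
    rw [wordProd_cons, mul_inv_rev, inv_simple, rep_mul, ← rep_mul cs (cs.simple k)] at hneg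
    rcases rep_pos_or_neg cs (cs.simple k * x) i with h | h
    · obtain ⟨l₁, j, l₂, rfl, hr⟩ := ih _ h hneg
      refine ⟨k :: l₁, j, l₂, by simp, ?_⟩
      rw [wordProd_cons, rep_mul, ← hr, ← rep_mul]
      simp
    · refine ⟨[], k, l, by simp, ?_⟩
      rw [wordProd_nil, rep_one]
      have hz : ∀ j, j ≠ k → rep cs x (sr i) j = 0 := by
        intro j hj
        apply le_antisymm _ (hpos j)
        rw [← rep_simple_coord cs hj (rep cs x (sr i)), ← rep_mul]
        exact h j
      have hsm : rep cs x (sr i) = (rep cs x (sr i) k) • sr k := by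
        ext j
        by_cases hj : j = k
        · subst hj; simp [sr_self]
        · simp [hz j hj, sr_ne hj]
      have hn : bf M (rep cs x (sr i)) (rep cs x (sr i)) = 1 := by rw [bf_rep, bf_self]
      rw [hsm] at hn
      simp only [map_smul, LinearMap.smul_apply, bf_self, smul_eq_mul, mul_one] at hn
      have hk0 : 0 ≤ rep cs x (sr i) k := hpos k
      have : rep cs x (sr i) k = 1 := by nlinarith
      rw [hsm, this, one_smul]

theorem length_mul_refl_lt {v x : W} {i : B} (hpos : 0 ≤ rep cs x (sr i))
    (hneg : rep cs v (rep cs x (sr i)) ≤ 0) :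
    cs.length (v * (x * cs.simple i * x⁻¹)) < cs.length v := by
  obtain ⟨l, hl, hv⟩ := cs.exists_isReduced v⁻¹
  obtain ⟨l₁, j, l₂, rfl, hr⟩ := exchange cs l x i hpos (by rw [← hv, inv_inv]; exact hneg)
  rw [conj_eq_of_root_eq cs hr]
  have e : (v * (cs.wordProd l₁ * cs.simple j * (cs.wordProd l₁)⁻¹))⁻¹
      = cs.wordProd (l₁ ++ l₂) := by
    rw [mul_inv_rev, hv, wordProd_append, wordProd_cons, wordProd_append]
    simp [mul_assoc]
  rw [← length_inv, e, ← cs.length_inv v, hv, hl]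
  have := cs.length_wordProd_le (l₁ ++ l₂)
  simp only [List.length_append, List.length_cons] at this ⊢
  omega

end Pos

section Carter

set_option linter.unusedSectionVars false
set_option linter.unusedSimpArgs false

open CoxeterSystem

variable {B : Type*} {W : Type*} [Group W] {M : CoxeterMatrix B} [Fintype B] [DecidableEq B]
variable (cs : CoxeterSystem M W)

theorem rep_wordProd_coord (l : List B) (k : B) (hk : k ∉ l) (y : B → ℝ) :
    rep cs (cs.wordProd l) y k = y k := by
  induction l with
  | nil => rw [wordProd_nil, rep_one]
  | cons j l ih =>
    simp only [List.mem_cons, not_or] at hk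
    rw [wordProd_cons, rep_mul, rep_simple_coord cs hk.1, ih hk.2]

theorem fixed_of_wordProd_fixed (l : List B) (hl : l.Nodup) (y : B → ℝ)
    (hy : rep cs (cs.wordProd l) y = y) : ∀ j ∈ l, rep cs (cs.simple j) y = y := by
  induction l with
  | nil => simp
  | cons k l ih =>
    rw [List.nodup_cons] at hl
    rw [wordProd_cons, rep_mul] at hy
    have h1 : rep cs (cs.wordProd l) y = rep cs (cs.simple k) y := by
      conv_rhs => rw [← hy]
      rw [← rep_mul]; simp [rep_one]
    have h2 := congrFun h1 k
    rw [rep_wordProd_coord cs l k hl.1, rep_simple_apply] at h2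
    simp only [Pi.sub_apply, Pi.smul_apply, sr_self, smul_eq_mul, mul_one] at h2
    have h3 : 2 * bf M (sr k) y = 0 := by linarith
    have h4 : rep cs (cs.simple k) y = y := by rw [rep_simple_apply, h3]; simp
    intro j hj
    rcases List.mem_cons.mp hj with rfl | hj
    · exact h4
    · exact ih hl.2 (h1.trans h4) j hj

theorem exists_root_space (L : List W) (hL : ∀ t ∈ L, cs.IsReflection t) :
    ∃ U : Submodule ℝ (B → ℝ), Module.finrank ℝ U ≤ L.length ∧
      ∀ t ∈ L, ∀ x, rep cs t x - x ∈ U := by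
  induction L with
  | nil => exact ⟨⊥, by simp, by simp⟩
  | cons t L ih =>
    obtain ⟨U, hU, hU2⟩ := ih (fun t ht => hL t (List.mem_cons_of_mem _ ht))
    obtain ⟨g, i, rfl⟩ := hL t List.mem_cons_self
    refine ⟨U ⊔ Submodule.span ℝ {rep cs g (sr i)}, ?_, ?_⟩
    · have h1 := Submodule.finrank_add_le_finrank_add_finrank U
        (Submodule.span ℝ {rep cs g (sr i)})
      have h2 : Module.finrank ℝ (Submodule.span ℝ {rep cs g (sr i)}) ≤ 1 := by
        simpa using finrank_span_le_card (R := ℝ) ({rep cs g (sr i)} : Set (B → ℝ))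
      simp only [List.length_cons]
      omega
    · intro t ht x
      rcases List.mem_cons.mp ht with rfl | ht
      · rw [rep_conj, sub_sub_cancel_left, ← neg_smul]
        exact Submodule.mem_sup_right (Submodule.smul_mem _ _ (Submodule.mem_span_singleton_self _))
      · exact Submodule.mem_sup_left (hU2 t ht x)

theorem prod_sub_mem (U : Submodule ℝ (B → ℝ)) (L : List W)
    (h : ∀ t ∈ L, ∀ x, rep cs t x - x ∈ U) (x : B → ℝ) : rep cs L.prod x - x ∈ U := by
  induction L with
  | nil => simp
  | cons t L ih =>
    rw [List.prod_cons, rep_mul]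
    have h1 := h t List.mem_cons_self (rep cs L.prod x)
    have h2 := ih (fun t ht => h t (List.mem_cons_of_mem _ ht))
    have := U.add_mem h1 h2
    simpa using this

/-- Averaged invariant form. -/
noncomputable def qf [Fintype W] : (B → ℝ) →ₗ[ℝ] (B → ℝ) →ₗ[ℝ] ℝ :=
  LinearMap.mk₂ ℝ (fun x y => ∑ g : W, ∑ b : B, rep cs g x b * rep cs g y b)
    (by intros; simp [add_mul, Finset.sum_add_distrib])
    (by intros; simp [Finset.mul_sum, mul_assoc])
    (by intros; simp [mul_add, Finset.sum_add_distrib])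
    (by intros; simp [Finset.mul_sum, mul_left_comm])

theorem qf_apply [Fintype W] (x y : B → ℝ) :
    qf cs x y = ∑ g : W, ∑ b : B, rep cs g x b * rep cs g y b := rfl

theorem qf_rep [Fintype W] (w : W) (x y : B → ℝ) :
    qf cs (rep cs w x) (rep cs w y) = qf cs x y := by
  rw [qf_apply, qf_apply]
  simp only [← rep_mul]
  exact Equiv.sum_comp (Equiv.mulRight w) (fun g : W => ∑ b : B, rep cs g x b * rep cs g y b)

theorem qf_inj [Fintype W] : Function.Injective (qf cs) := by
  rw [injective_iff_map_eq_zero]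
  intro x hx
  have h : qf cs x x = 0 := by rw [hx]; rfl
  rw [qf_apply, Finset.sum_eq_zero_iff_of_nonneg
    (fun g _ => Finset.sum_nonneg fun b _ => mul_self_nonneg _)] at h
  have h1 := h 1 (Finset.mem_univ _)
  rw [Finset.sum_eq_zero_iff_of_nonneg (fun b _ => mul_self_nonneg _)] at h1
  ext b
  have := h1 b (Finset.mem_univ _)
  rw [rep_one] at this
  simpa using this

theorem qf_surj [Fintype W] : Function.Surjective (qf cs) := by
  refine (LinearMap.injective_iff_surjective_of_finrank_eq_finrank ?_).mp (qf_inj cs)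
  exact (Subspace.dual_finrank_eq (K := ℝ) (V := B → ℝ)).symm

theorem sr_mem_of_image [Finite W] (l : List B) (hl : l.Nodup) (U : Submodule ℝ (B → ℝ))
    (hU : ∀ x, rep cs (cs.wordProd l) x - x ∈ U) (j : B) (hj : j ∈ l) : sr j ∈ U := by
  have := Fintype.ofFinite W
  by_contra hn
  obtain ⟨f, hf, hfU⟩ := Submodule.exists_le_ker_of_notMem hn
  obtain ⟨y, rfl⟩ := qf_surj cs f
  apply hf
  have h1 : ∀ x, qf cs y (rep cs (cs.wordProd l) x) = qf cs y x := by
    intro x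
    have := hfU (hU x)
    rw [LinearMap.mem_ker, map_sub] at this
    linarith
  have h2 : rep cs (cs.wordProd l) y = y := by
    apply qf_inj cs
    refine LinearMap.ext fun x => ?_
    have e1 := h1 (rep cs (cs.wordProd l)⁻¹ x)
    rw [rep_rep_inv] at e1
    have e2 := qf_rep cs (cs.wordProd l) y (rep cs (cs.wordProd l)⁻¹ x)
    rw [rep_rep_inv] at e2
    rw [e2, e1]
  have h3 := fixed_of_wordProd_fixed cs l hl y h2 j hj
  have h4 := qf_rep cs (cs.simple j) y (sr j)
  rw [h3, rep_simple_self, map_neg] at h4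
  linarith

theorem exists_min_factorization (w : W) : ∃ L : List W,
    (∀ t ∈ L, cs.IsReflection t) ∧ L.length = absLength cs w ∧ L.prod = w := by
  have : (absLength cs w) ∈ {k | ∃ l : List W, (∀ t ∈ l, cs.IsReflection t) ∧ l.length = k ∧
      l.prod = w} := by
    apply Nat.sInf_mem
    obtain ⟨l, rfl⟩ := cs.wordProd_surjective w
    refine ⟨_, l.map cs.simple, ?_, rfl, rfl⟩
    intro t ht
    obtain ⟨i, _, rfl⟩ := List.mem_map.mp ht
    exact cs.isReflection_simple i
  exact this

theorem absLength_wordProd_le (l : List B) : absLength cs (cs.wordProd l) ≤ l.length := by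
  apply Nat.sInf_le
  refine ⟨l.map cs.simple, ?_, by simp, rfl⟩
  intro t ht
  obtain ⟨i, _, rfl⟩ := List.mem_map.mp ht
  exact cs.isReflection_simple i

theorem coord_fixed [Finite W] (l : List B) (hl : l.Nodup) (i : B)
    (hmem : ∀ j, j ≠ i → j ∈ l) (v u : W) (hvu : v * u = cs.wordProd l)
    (hlen : absLength cs v + absLength cs u + 1 ≤ Fintype.card B) (x : B → ℝ) :
    rep cs v x i = x i := by
  obtain ⟨L1, hL1, hlen1, rfl⟩ := exists_min_factorization cs v
  obtain ⟨L2, hL2, hlen2, rfl⟩ := exists_min_factorization cs u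
  obtain ⟨U, hU, hU2⟩ := exists_root_space cs (L1 ++ L2) (by
    intro t ht
    rcases List.mem_append.mp ht with h | h
    · exact hL1 t h
    · exact hL2 t h)
  rw [List.length_append] at hU
  have hsr : ∀ j, j ≠ i → sr j ∈ U := by
    intro j hj
    refine sr_mem_of_image cs l hl U (fun x => ?_) j (hmem j hj)
    rw [← hvu, ← List.prod_append]
    exact prod_sub_mem cs U _ hU2 x
  have hle : LinearMap.ker (LinearMap.proj i : (B → ℝ) →ₗ[ℝ] ℝ) ≤ U := by
    intro z hz
    have hz0 : z i = 0 := hz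
    have e : z = ∑ j, z j • sr j := by
      ext b
      simp [sr, Finset.sum_apply, Pi.single_apply]
    rw [e]
    refine Submodule.sum_mem _ fun j _ => ?_
    by_cases hj : j = i
    · subst hj; rw [hz0, zero_smul]; exact U.zero_mem
    · exact U.smul_mem _ (hsr j hj)
  have hrn := LinearMap.finrank_range_add_finrank_ker (LinearMap.proj i : (B → ℝ) →ₗ[ℝ] ℝ)
  have hr1 : Module.finrank ℝ (LinearMap.range (LinearMap.proj i : (B → ℝ) →ₗ[ℝ] ℝ)) ≤ 1 := by
    simpa using Submodule.finrank_le (LinearMap.range (LinearMap.proj i : (B → ℝ) →ₗ[ℝ] ℝ))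
  rw [Module.finrank_fintype_fun_eq_card] at hrn
  have heq := Submodule.eq_of_le_of_finrank_le hle (by omega)
  have := prod_sub_mem cs U L1 (fun t ht => hU2 t (List.mem_append_left _ ht)) x
  rw [← heq, LinearMap.mem_ker] at this
  simp only [LinearMap.proj_apply, Pi.sub_apply] at this
  linarith

theorem bruhatLt_length {v w : W} (h : BruhatLt cs v w) : cs.length v < cs.length w := by
  induction h with
  | single h => exact h.2
  | tail _ h ih => exact ih.trans h.2

theorem main_length [Finite W] (l : List B) (hl : l.Nodup) (hmem : ∀ i, i ∈ l) (v w : W)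
    (hw : AbsLe cs w (cs.wordProd l))
    (hcov : AbsCovBy cs v w) (hlt : cs.length w < cs.length v) :
    cs.length (w⁻¹ * cs.wordProd l) < cs.length (v⁻¹ * cs.wordProd l) := by
  obtain ⟨⟨x, i, hx⟩, habs⟩ := hcov
  -- choose a positive root
  obtain ⟨x, hx, hpos⟩ : ∃ x, v⁻¹ * w = x * cs.simple i * x⁻¹ ∧ 0 ≤ rep cs x (sr i) := by
    rcases rep_pos_or_neg cs x i with h | h
    · exact ⟨x, hx, h⟩
    · refine ⟨x * cs.simple i, by rw [hx]; simp [mul_assoc], ?_⟩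
      rw [rep_mul, rep_simple_self, map_neg]
      simpa using h
  have hwv : w = v * (x * cs.simple i * x⁻¹) := by rw [← hx]; simp
  -- the root is made negative by v
  have hvneg : rep cs v (rep cs x (sr i)) ≤ 0 := by
    have h0 := rep_pos_or_neg cs (v * x) i
    rw [rep_mul] at h0
    refine h0.resolve_left fun h => ?_
    have := length_mul_refl_lt cs (v := w) hpos (by
      have e : w * x = v * x * cs.simple i := by rw [hwv]; simp [mul_assoc]
      rw [← rep_mul, e, rep_mul, rep_simple_self, map_neg, rep_mul]
      simpa using h)
    have e : w * (x * cs.simple i * x⁻¹) = v := by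
      rw [hwv]; simp [mul_assoc]
    rw [e] at this
    omega
  have e1 : (w⁻¹ * cs.wordProd l)⁻¹ = ((cs.wordProd l)⁻¹ * v) * (x * cs.simple i * x⁻¹) := by
    rw [← hx]; simp [mul_assoc]
  have e2 : (v⁻¹ * cs.wordProd l)⁻¹ = (cs.wordProd l)⁻¹ * v := by simp
  rw [← cs.length_inv (w⁻¹ * _), ← cs.length_inv (v⁻¹ * _), e1, e2]
  apply length_mul_refl_lt cs hpos
  rw [← rep_mul]
  refine (rep_pos_or_neg cs ((cs.wordProd l)⁻¹ * v * x) i).symm.elim (fun h => h) fun h => ?_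
  exfalso
  -- the positive root `β = - v γ`
  have hβ : rep cs (v * x * cs.simple i) (sr i) = - rep cs v (rep cs x (sr i)) := by
    rw [rep_mul, rep_simple_self, map_neg, rep_mul]
  obtain ⟨l₁, j, l₂, rfl, hr⟩ := exchange cs l (v * x * cs.simple i) i
    (by rw [hβ]; simpa using hvneg)
    (by rw [hβ, map_neg, ← rep_mul, ← rep_mul]; simpa using h)
  have hconj := conj_eq_of_root_eq cs hr
  have hnd := hl
  rw [List.nodup_middle, List.nodup_cons] at hnd
  have hj1 : j ∉ l₁ := fun h => hnd.1 (List.mem_append_left _ h)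
  have hfix := coord_fixed cs (l₁ ++ l₂) hnd.2 j (by
    intro k hk
    have := hmem k
    simp only [List.mem_append, List.mem_cons] at this ⊢
    tauto) v (w⁻¹ * cs.wordProd (l₁ ++ j :: l₂)) (by
      have : v * w⁻¹ = cs.wordProd l₁ * cs.simple j * (cs.wordProd l₁)⁻¹ := by
        rw [← hconj, hwv]; simp [mul_assoc]
      rw [← mul_assoc, this, wordProd_append, wordProd_append, wordProd_cons]
      simp [mul_assoc]) (by
      have hc1 := absLength_wordProd_le cs (l₁ ++ j :: l₂)
      have hc2 : (l₁ ++ j :: l₂).length ≤ Fintype.card B := hl.length_le_card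
      unfold AbsLe at hw
      omega)
  have h5 := hfix (rep cs x (sr i))
  have h6 := congrFun (hβ.symm.trans hr) j
  rw [rep_wordProd_coord cs l₁ j hj1, sr_self, Pi.neg_apply, h5] at h6
  have h7 : 0 ≤ rep cs x (sr i) j := hpos j
  linarith

end Carter

/-- Proposition 3.3 (i): for a cover `v ⋖ w` in `NC(W,c)`, if `v >_B w` then
`K(v) >_B K(w)` where `K(u) = u⁻¹c` is the Kreweras complement. -/
theorem stmt8 [Finite W] (cs : CoxeterSystem M W) (c : W)
    (hc : IsStdCoxeterElement cs c) (v w : W)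
    (hv : AbsLe cs v c) (hw : AbsLe cs w c)
    (hcov : AbsCovBy cs v w) (hB : BruhatLt cs w v) :
    BruhatLt cs (w⁻¹ * c) (v⁻¹ * c) := by
  classical
  obtain ⟨l, hl, hmem, rfl⟩ := hc
  have : Fintype B := ⟨l.toFinset, fun i => List.mem_toFinset.mpr (hmem i)⟩
  refine Relation.TransGen.single ⟨?_, ?_⟩
  · have h := (hcov.1.conj w).conj (cs.wordProd l)⁻¹
    have e : (w⁻¹ * cs.wordProd l)⁻¹ * (v⁻¹ * cs.wordProd l)
        = (cs.wordProd l)⁻¹ * (w * (v⁻¹ * w) * w⁻¹) * ((cs.wordProd l)⁻¹)⁻¹ := by group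
    rw [e]
    exact h
  · exact main_length cs l hl hmem v w hw hcov (bruhatLt_length cs hB)

end NCpaper
end

section
/- Let c be a standard Coxeter element of a finite Coxeter system (W,S) and let v, w ∈ NC(W,c) with v ⋖ w a cover in absolute order, and suppose v has full support (supp(v) = S). If K(v) >_B K(w) then v >_B w, where K(u) = u⁻¹c. -/
namespace NCpaper

open CoxeterSystem

variable {B : Type*} {W : Type*} [Group W] {M : CoxeterMatrix B}

section Rep


variable [Fintype B] [DecidableEq B]

/-- The simple roots. -/
noncomputable def al (i : B) : B → ℝ := Pi.single i 1

/-- The simple coroots of the geometric representation. -/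
noncomputable def co (M : CoxeterMatrix B) (i : B) : Module.Dual ℝ (B → ℝ) :=
  ∑ k, (-2 * Real.cos (Real.pi / (M i k : ℝ))) • LinearMap.proj k

theorem co_apply (M : CoxeterMatrix B) (i : B) (x : B → ℝ) :
    co M i x = ∑ k, -2 * Real.cos (Real.pi / (M i k : ℝ)) * x k := by
  simp [co]

theorem co_al (M : CoxeterMatrix B) (i j : B) :
    co M i (al j) = -2 * Real.cos (Real.pi / (M i j : ℝ)) := by
  simp [co_apply, al, Pi.single_apply]

theorem co_al_self (M : CoxeterMatrix B) (i : B) : co M i (al i) = 2 := by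
  simp [co_al]

/-- The simple reflections in the geometric representation. -/
noncomputable def sg (M : CoxeterMatrix B) (i : B) : (B → ℝ) ≃ₗ[ℝ] (B → ℝ) :=
  Module.reflection (co_al_self M i)

theorem sg_apply (M : CoxeterMatrix B) (i : B) (x : B → ℝ) :
    sg M i x = x - co M i x • al i := Module.reflection_apply _ _

theorem sg_liftable (M : CoxeterMatrix B) : M.IsLiftable (sg M) := by
  intro i j
  rcases eq_or_ne i j with rfl | hij
  · rw [M.diagonal, pow_one]
    ext x : 1
    exact Module.involutive_reflection (co_al_self M i) x
  have h1 := M.off_diagonal i j hij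
  change M i j ≠ 1 at h1
  rcases Nat.eq_zero_or_pos (M i j) with h0 | hpos
  · rw [h0, pow_zero]
  rcases eq_or_ne (M i j) 2 with h2 | h2
  · have c1 : co M i (al j) = 0 := by rw [co_al, h2]; simp
    have c2 : co M j (al i) = 0 := by rw [co_al, ← M.symmetric i j, h2]; simp
    rw [h2, pow_two]
    ext x : 1
    have e1 := co_al_self M i
    have e2 := co_al_self M j
    simp only [LinearEquiv.mul_apply, sg_apply, map_sub, map_smul, c1, c2, e1, e2,
      LinearEquiv.coe_one, id]
    ext k
    simp
    ring
  have h3 : 3 ≤ M i j := by omega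
  set m := M i j with hm
  have hmR : (3 : ℝ) ≤ m := by exact_mod_cast h3
  set θ : ℝ := 2 * (Real.pi / m) with hθ
  have hmθ : (m : ℝ) * θ = 2 * Real.pi := by rw [hθ]; field_simp
  have hsin : Real.sin θ ≠ 0 := by
    apply ne_of_gt
    apply Real.sin_pos_of_pos_of_lt_pi
    · have := Real.pi_pos; positivity
    · have := Real.pi_pos
      nlinarith
  have ht : 2 * Real.cos θ = co M i (al j) * co M j (al i) - 2 := by
    rw [co_al, co_al, ← M.symmetric i j, ← hm, hθ, Real.cos_two_mul]; ring
  have key : ∀ k : ℤ, ((Polynomial.Chebyshev.S ℝ k).eval (2 * Real.cos θ)) * Real.sin θ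
      = Real.sin ((k + 1) * θ) := fun k => Polynomial.Chebyshev.S_two_mul_real_cos θ k
  ext z : 1
  unfold sg
  rw [Module.reflection_mul_reflection_pow_apply _ _ m z _ ht]
  rcases Nat.even_or_odd' m with ⟨k, hk | hk⟩
  · have i1 : ((m : ℤ) - 2) / 2 = (k : ℤ) - 1 := by omega
    have i2 : ((m : ℤ) - 1) / 2 = (k : ℤ) - 1 := by omega
    have z1 : (Polynomial.Chebyshev.S ℝ ((k : ℤ) - 1)).eval (2 * Real.cos θ) = 0 := by
      have := key ((k : ℤ) - 1)
      have hh : (((k : ℤ) - 1 : ℤ) + 1 : ℝ) * θ = Real.pi := by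
        have : (m : ℝ) = 2 * k := by exact_mod_cast hk
        rw [this] at hmθ
        push_cast
        linarith
      rw [hh, Real.sin_pi] at this
      exact (mul_eq_zero.mp this).resolve_right hsin
    rw [i1, i2, z1]
    simp
  · have i1 : ((m : ℤ) - 2) / 2 = (k : ℤ) - 1 := by omega
    have i2 : ((m : ℤ) - 1) / 2 = (k : ℤ) := by omega
    have i3 : ((m : ℤ) - 3) / 2 = (k : ℤ) - 1 := by omega
    have i4 : ((m : ℤ)) / 2 = (k : ℤ) := by omega
    have z1 : (Polynomial.Chebyshev.S ℝ (k : ℤ)).eval (2 * Real.cos θ) +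
        (Polynomial.Chebyshev.S ℝ ((k : ℤ) - 1)).eval (2 * Real.cos θ) = 0 := by
      have a1 := key (k : ℤ)
      have a2 := key ((k : ℤ) - 1)
      have hh : ((k : ℤ) + 1 : ℝ) * θ = 2 * Real.pi - (((k : ℤ) - 1 : ℤ) + 1 : ℝ) * θ := by
        have : (m : ℝ) = 2 * k + 1 := by exact_mod_cast hk
        rw [this] at hmθ
        push_cast
        linarith
      rw [hh, Real.sin_two_pi_sub] at a1
      have : ((Polynomial.Chebyshev.S ℝ (k : ℤ)).eval (2 * Real.cos θ) +
        (Polynomial.Chebyshev.S ℝ ((k : ℤ) - 1)).eval (2 * Real.cos θ)) * Real.sin θ = 0 := by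
        linarith
      exact (mul_eq_zero.mp this).resolve_right hsin
    rw [i1, i2, i3, i4, z1]
    simp

/-- The geometric representation. -/
noncomputable def rho (cs : CoxeterSystem M W) : W →* ((B → ℝ) ≃ₗ[ℝ] (B → ℝ)) :=
  cs.lift ⟨sg M, sg_liftable M⟩

theorem rho_simple (cs : CoxeterSystem M W) (i : B) : rho cs (cs.simple i) = sg M i :=
  cs.lift_apply_simple (sg_liftable M) i

theorem rho_simple_apply (cs : CoxeterSystem M W) (i : B) (x : B → ℝ) :
    rho cs (cs.simple i) x = x - co M i x • al i := by rw [rho_simple, sg_apply]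

theorem rho_mul_apply (cs : CoxeterSystem M W) (u v : W) (x : B → ℝ) :
    rho cs (u * v) x = rho cs u (rho cs v x) := by rw [map_mul]; rfl

theorem rho_one_apply (cs : CoxeterSystem M W) (x : B → ℝ) :
    rho cs 1 x = x := by rw [map_one]; rfl

theorem rho_simple_al (cs : CoxeterSystem M W) (i : B) :
    rho cs (cs.simple i) (al i) = - al i := by
  rw [rho_simple_apply, co_al_self]; module

/-- q-integers -/
noncomputable def qn (θ : ℝ) (k : ℕ) : ℝ :=
  (Polynomial.Chebyshev.S ℝ ((k : ℤ) - 1)).eval (2 * Real.cos θ)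

theorem qn_succ_succ (θ : ℝ) (k : ℕ) :
    qn θ (k + 2) = 2 * Real.cos θ * qn θ (k + 1) - qn θ k := by
  have := Polynomial.Chebyshev.S_add_two ℝ ((k : ℤ) - 1)
  unfold qn
  have e1 : (((k + 2 : ℕ) : ℤ) - 1) = ((k : ℤ) - 1) + 2 := by push_cast; ring
  have e2 : (((k + 1 : ℕ) : ℤ) - 1) = ((k : ℤ) - 1) + 1 := by push_cast; ring
  rw [e1, e2, this]
  simp

theorem qn_zero (θ : ℝ) : qn θ 0 = 0 := by simp [qn]
theorem qn_one (θ : ℝ) : qn θ 1 = 1 := by simp [qn]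

theorem qn_nonneg (m k : ℕ) (hm : m ≠ 1) (hk : m ≠ 0 → k ≤ m) : 0 ≤ qn (Real.pi / m) k := by
  rcases eq_or_ne m 0 with rfl | h0
  · unfold qn
    simp only [Nat.cast_zero, div_zero, Real.cos_zero, mul_one]
    rw [Polynomial.Chebyshev.S_eval_two]
    push_cast
    simp
  have h2 : 2 ≤ m := by omega
  have hmR : (2 : ℝ) ≤ m := by exact_mod_cast h2
  have hkR : (k : ℝ) ≤ m := by exact_mod_cast hk h0
  have hp := Real.pi_pos
  have hs : 0 < Real.sin (Real.pi / m) := by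
    apply Real.sin_pos_of_pos_of_lt_pi
    · positivity
    · rw [div_lt_iff₀ (by linarith)]; nlinarith
  have := Polynomial.Chebyshev.S_two_mul_real_cos (Real.pi / m) ((k : ℤ) - 1)
  have h3 : 0 ≤ Real.sin ((((k : ℤ) - 1 : ℤ) + 1) * (Real.pi / m)) := by
    apply Real.sin_nonneg_of_nonneg_of_le_pi
    · push_cast
      have : (0 : ℝ) ≤ k := by positivity
      have : (k : ℝ) - 1 + 1 = k := by ring
      rw [this]; positivity
    · push_cast
      have : (k : ℝ) - 1 + 1 = k := by ring
      rw [this, ← mul_div_assoc, div_le_iff₀ (by linarith)]; nlinarith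
  rw [← this] at h3
  exact nonneg_of_mul_nonneg_left h3 hs

theorem rho_alt (cs : CoxeterSystem M W) (i j : B) (p : ℕ) :
    rho cs (cs.wordProd (alternatingWord i j p)) (al i) =
      if Even p then qn (Real.pi / M i j) (p + 1) • al i + qn (Real.pi / M i j) p • al j
      else qn (Real.pi / M i j) p • al i + qn (Real.pi / M i j) (p + 1) • al j := by
  induction p with
  | zero => simp [qn_zero, qn_one, alternatingWord]
  | succ p ih =>
    rw [alternatingWord_succ', wordProd_cons, rho_mul_apply, ih, qn_succ_succ]
    by_cases hp : Even p
    · have hp' : ¬ Even (p + 1) := by simpa [Nat.even_add_one] using hp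
      rw [if_pos hp, if_pos hp, if_neg hp', rho_simple_apply, map_add, map_smul, map_smul,
        co_al_self, co_al, M.symmetric j i]
      simp only [smul_eq_mul]
      module
    · have hp' : Even (p + 1) := by simpa [Nat.even_add_one] using hp
      rw [if_neg hp, if_neg hp, if_pos hp', rho_simple_apply, map_add, map_smul, map_smul,
        co_al_self, co_al]
      simp only [smul_eq_mul]
      module


theorem pos_of_lt (cs : CoxeterSystem M W) (w : W) (i : B)
    (h : cs.length w < cs.length (w * cs.simple i)) : ∀ k, 0 ≤ rho cs w (al i) k := by
  induction hn : cs.length w using Nat.strong_induction_on generalizing w i with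
  | _ n ih =>
  subst hn
  by_cases hw1 : w = 1
  · subst hw1
    intro k
    rw [rho_one_apply, al, Pi.single_apply]
    split_ifs <;> norm_num
  obtain ⟨j, hj⟩ := cs.exists_rightDescent_of_ne_one hw1
  have hij : i ≠ j := by
    rintro rfl
    exact absurd hj (not_lt.mpr h.le)
  classical
  let P : ℕ → Prop := fun p => ∃ v, w = v * cs.wordProd (alternatingWord i j p) ∧
    cs.length w = cs.length v + p
  have hb : ∀ p, P p → p ≤ cs.length w := by
    rintro p ⟨v, -, h2⟩; omega
  have hP1 : P 1 := by
    refine ⟨w * cs.simple j, by simp [alternatingWord], ?_⟩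
    rw [cs.isRightDescent_iff] at hj
    omega
  set p := Nat.findGreatest P (cs.length w) with hp
  have hPp : P p := Nat.findGreatest_spec (hb 1 hP1) hP1
  have hp1 : 1 ≤ p := Nat.le_findGreatest (hb 1 hP1) hP1
  have hPs : ¬ P (p + 1) := by
    intro hh
    have := Nat.le_findGreatest (hb _ hh) hh
    omega
  obtain ⟨v, hv1, hv2⟩ := hPp
  obtain ⟨q, hq⟩ : ∃ q, p = q + 1 := ⟨p - 1, by omega⟩
  -- both simple reflections go up from v
  have hA : cs.length v < cs.length (v * cs.simple (if Even q then j else i)) := by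
    by_contra hcon
    have h1 := cs.length_mul_simple v (if Even q then j else i)
    have h2 : w = (v * cs.simple (if Even q then j else i)) *
        cs.wordProd (alternatingWord i j q) := by
      rw [hv1, hq, alternatingWord_succ', wordProd_cons]; simp only [mul_assoc]
    have h3 := cs.length_mul_le (v * cs.simple (if Even q then j else i))
        (cs.wordProd (alternatingWord i j q))
    rw [← h2] at h3
    have h4 := cs.length_wordProd_le (alternatingWord i j q)
    rw [length_alternatingWord] at h4
    omega
  have hB : cs.length v < cs.length (v * cs.simple (if Even p then j else i)) := by
    by_contra hcon
    have h1 := cs.length_mul_simple v (if Even p then j else i)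
    apply hPs
    refine ⟨v * cs.simple (if Even p then j else i), ?_, by omega⟩
    rw [alternatingWord_succ', wordProd_cons, hv1]
    simp only [← mul_assoc, simple_mul_simple_cancel_right]
  have hboth : cs.length v < cs.length (v * cs.simple i) ∧
      cs.length v < cs.length (v * cs.simple j) := by
    by_cases he : Even q
    · have he' : ¬ Even p := by rw [hq]; simpa [Nat.even_add_one] using he
      rw [if_pos he] at hA
      rw [if_neg he'] at hB
      exact ⟨hB, hA⟩
    · have he' : Even p := by rw [hq]; simpa [Nat.even_add_one] using he
      rw [if_neg he] at hA
      rw [if_pos he'] at hB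
      exact ⟨hA, hB⟩
  have pi := ih (cs.length v) (by omega) v i hboth.1 rfl
  have pj := ih (cs.length v) (by omega) v j hboth.2 rfl
  -- p is less than the order
  have hpm : M i j ≠ 0 → p + 1 ≤ M i j := by
    intro hm0
    by_contra hcon
    have hsplit : ∀ d, ∃ l : List B, l.length = d ∧
        alternatingWord i j (d + M i j) = l ++ alternatingWord i j (M i j) := by
      intro d
      induction d with
      | zero => exact ⟨[], by simp⟩
      | succ d ihd =>
        obtain ⟨l, hl, hl'⟩ := ihd
        refine ⟨(if Even (d + M i j) then j else i) :: l, by simp [hl], ?_⟩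
        rw [show d + 1 + M i j = (d + M i j) + 1 by ring, alternatingWord_succ', hl']
        simp
    obtain ⟨l, hl, hl'⟩ := hsplit (p - M i j)
    rw [show p - M i j + M i j = p by omega] at hl'
    obtain ⟨r, hr⟩ : ∃ r, M i j = r + 1 := ⟨M i j - 1, by omega⟩
    have hbr := cs.wordProd_braidWord_eq i j
    unfold braidWord at hbr
    rw [← M.symmetric i j, hr, alternatingWord_succ j i, wordProd_concat] at hbr
    have h5 : w * cs.simple i = v * (cs.wordProd l * cs.wordProd (alternatingWord i j r)) := by
      rw [hv1, hl', wordProd_append, hr, hbr]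
      simp only [mul_assoc, simple_mul_simple_self, mul_one]
    have h6 := cs.length_mul_le v (cs.wordProd l * cs.wordProd (alternatingWord i j r))
    have h7 := cs.length_mul_le (cs.wordProd l) (cs.wordProd (alternatingWord i j r))
    have h8 := cs.length_wordProd_le (alternatingWord i j r)
    have h9 := cs.length_wordProd_le l
    rw [length_alternatingWord] at h8
    rw [← h5] at h6
    omega
  have h1 := M.off_diagonal i j hij
  have q1 : 0 ≤ qn (Real.pi / M i j) p := qn_nonneg _ _ h1 (fun h => by have := hpm h; omega)
  have q2 : 0 ≤ qn (Real.pi / M i j) (p + 1) := qn_nonneg _ _ h1 hpm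
  intro k
  rw [hv1, rho_mul_apply, rho_alt]
  have := pi k
  have := pj k
  split_ifs <;> simp only [map_add, map_smul, Pi.add_apply, Pi.smul_apply, smul_eq_mul] <;>
    positivity

theorem neg_of_descent (cs : CoxeterSystem M W) (w : W) (i : B)
    (h : cs.IsRightDescent w i) : ∀ k, rho cs w (al i) k ≤ 0 := by
  intro k
  have := pos_of_lt cs (w * cs.simple i) i (by rw [simple_mul_simple_cancel_right]; exact h) k
  rw [rho_mul_apply, rho_simple_al, map_neg, Pi.neg_apply] at this
  linarith

theorem pos_or_neg (cs : CoxeterSystem M W) (w : W) (i : B) :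
    (∀ k, 0 ≤ rho cs w (al i) k) ∨ (∀ k, rho cs w (al i) k ≤ 0) := by
  by_cases h : cs.IsRightDescent w i
  · exact Or.inr (neg_of_descent cs w i h)
  · left
    apply pos_of_lt
    rw [cs.not_isRightDescent_iff] at h
    omega

theorem rho_al_ne_zero (cs : CoxeterSystem M W) (w : W) (i : B) : rho cs w (al i) ≠ 0 := by
  intro h
  rw [LinearEquiv.map_eq_zero_iff] at h
  have := congrFun h i
  simp [al] at this

theorem rho_faithful (cs : CoxeterSystem M W) (w : W) (h : ∀ x, rho cs w x = x) : w = 1 := by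
  by_contra hw
  obtain ⟨j, hj⟩ := cs.exists_rightDescent_of_ne_one hw
  have := neg_of_descent cs w j hj j
  rw [h] at this
  simp [al] at this
  linarith

/-- The invariant form. -/
noncomputable def bet (cs : CoxeterSystem M W) [Fintype W] : (B → ℝ) →ₗ[ℝ] (B → ℝ) →ₗ[ℝ] ℝ :=
  LinearMap.mk₂ ℝ (fun x y => ∑ w : W, ∑ k, rho cs w x k * rho cs w y k)
    (by intros; simp [add_mul, Finset.sum_add_distrib])
    (by intros; simp [Finset.mul_sum, mul_assoc])
    (by intros; simp [mul_add, Finset.sum_add_distrib])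
    (by intros; simp [Finset.mul_sum, mul_left_comm])

theorem bet_apply (cs : CoxeterSystem M W) [Fintype W] (x y : B → ℝ) :
    bet cs x y = ∑ w : W, ∑ k, rho cs w x k * rho cs w y k := rfl

theorem bet_symm (cs : CoxeterSystem M W) [Fintype W] (x y : B → ℝ) :
    bet cs x y = bet cs y x := by
  simp [bet_apply, mul_comm]

theorem bet_inv (cs : CoxeterSystem M W) [Fintype W] (u : W) (x y : B → ℝ) :
    bet cs (rho cs u x) (rho cs u y) = bet cs x y := by
  simp only [bet_apply, ← rho_mul_apply]
  exact Fintype.sum_equiv (Equiv.mulRight u) _ _ (fun w => rfl)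

theorem bet_pos (cs : CoxeterSystem M W) [Fintype W] (x : B → ℝ) (hx : x ≠ 0) :
    0 < bet cs x x := by
  have h0 : ∀ w : W, 0 ≤ ∑ k, rho cs w x k * rho cs w x k :=
    fun w => Finset.sum_nonneg (fun k _ => mul_self_nonneg _)
  rw [bet_apply]
  apply Finset.sum_pos' (fun w _ => h0 w)
  refine ⟨1, Finset.mem_univ _, ?_⟩
  obtain ⟨k, hk⟩ := Function.ne_iff.mp hx
  apply Finset.sum_pos' (fun k _ => mul_self_nonneg _)
  refine ⟨k, Finset.mem_univ _, ?_⟩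
  rw [rho_one_apply]
  exact mul_self_pos.mpr hk

theorem al_ne_zero (i : B) : (al i) ≠ 0 := by
  intro h
  have := congrFun h i
  simp [al] at this

theorem co_eq (cs : CoxeterSystem M W) [Fintype W] (i : B) (x : B → ℝ) :
    co M i x * bet cs (al i) (al i) = 2 * bet cs x (al i) := by
  have h := bet_inv cs (cs.simple i) x (al i)
  rw [rho_simple_al, rho_simple_apply] at h
  simp only [map_sub, map_neg, map_smul, LinearMap.sub_apply, LinearMap.smul_apply,
    smul_eq_mul] at h
  linarith

theorem conj_eq (cs : CoxeterSystem M W) [Finite W] (z : W) (i j : B) (a : ℝ) 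
    (h : rho cs z (al j) = a • al i) : z * cs.simple j * z⁻¹ = cs.simple i := by
  haveI := Fintype.ofFinite W
  have ha : a ≠ 0 := by
    rintro rfl
    exact rho_al_ne_zero cs z j (by rw [h, zero_smul])
  have key : ∀ y, rho cs (z * cs.simple j * z⁻¹) y = rho cs (cs.simple i) y := by
    intro y
    rw [rho_mul_apply, rho_mul_apply, rho_simple_apply, rho_simple_apply, map_sub, map_smul, h,
      ← rho_mul_apply, mul_inv_cancel, rho_one_apply, smul_smul]
    congr 2
    have e1 := co_eq cs j (rho cs z⁻¹ y)
    have e2 := co_eq cs i y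
    rw [← bet_inv cs z, ← bet_inv cs z (rho cs z⁻¹ y), ← rho_mul_apply, mul_inv_cancel,
      rho_one_apply, h] at e1
    simp only [map_smul, LinearMap.smul_apply, smul_eq_mul] at e1
    have hp := bet_pos cs (al i) (al_ne_zero i)
    have : (co M j (rho cs z⁻¹ y) * a - co M i y) * (a * bet cs (al i) (al i)) = 0 := by
      linear_combination e1 - a * e2
    have h3 := (mul_eq_zero.mp this).resolve_right (mul_ne_zero ha hp.ne')
    linarith
  have := rho_faithful cs ((cs.simple i)⁻¹ * (z * cs.simple j * z⁻¹)) (fun x => by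
    rw [rho_mul_apply, key, ← rho_mul_apply, inv_mul_cancel, rho_one_apply])
  exact (inv_mul_eq_one.mp this).symm

/-- Strong exchange. -/
theorem exchange_s9 (cs : CoxeterSystem M W) [Finite W] (x : W) (j : B)
    (hx : ∀ k, 0 ≤ rho cs x (al j) k) (ω : List B)
    (h : ∀ k, rho cs (cs.wordProd ω * x) (al j) k ≤ 0) :
    ∃ p, p < ω.length ∧ cs.wordProd ω * (x * cs.simple j * x⁻¹) = cs.wordProd (ω.eraseIdx p) := by
  induction ω with
  | nil =>
    exfalso
    apply rho_al_ne_zero cs x j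
    funext k
    have := h k
    rw [wordProd_nil, one_mul] at this
    exact le_antisymm this (hx k)
  | cons i ω ih =>
    rcases pos_or_neg cs (cs.wordProd ω * x) j with hp | hn
    · refine ⟨0, by simp, ?_⟩
      have hz : rho cs (cs.wordProd ω * x) (al j) =
          (rho cs (cs.wordProd ω * x) (al j) i) • al i := by
        funext k
        rcases eq_or_ne k i with rfl | hki
        · simp [al]
        · have h1 := hp k
          have h2 := h k
          rw [wordProd_cons, mul_assoc, rho_mul_apply, rho_simple_apply] at h2
          have h3 : al i k = 0 := by simp [al, hki]
          rw [Pi.sub_apply, Pi.smul_apply, h3, smul_zero, sub_zero] at h2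
          rw [Pi.smul_apply, h3, smul_zero]
          exact le_antisymm h2 h1
      have := conj_eq cs _ i j _ hz
      rw [List.eraseIdx_cons_zero, wordProd_cons, ← this]
      have e : cs.simple j * cs.simple j = 1 := cs.simple_mul_simple_self j
      simp only [mul_inv_rev, mul_assoc, inv_mul_cancel_left, mul_inv_cancel]
      simp
    · obtain ⟨p, hp, hp'⟩ := ih hn
      refine ⟨p + 1, by simpa using hp, ?_⟩
      rw [List.eraseIdx_cons_succ, wordProd_cons, wordProd_cons, mul_assoc, hp']

theorem length_lt_of_neg (cs : CoxeterSystem M W) [Finite W] (x : W) (j : B)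
    (hx : ∀ k, 0 ≤ rho cs x (al j) k) (w : W)
    (h : ∀ k, rho cs (w * x) (al j) k ≤ 0) :
    cs.length (w * (x * cs.simple j * x⁻¹)) < cs.length w := by
  obtain ⟨ω, hω, rfl⟩ := cs.exists_isReduced w
  obtain ⟨p, hp, hp'⟩ := exchange_s9 cs x j hx ω h
  rw [hp', hω.eq]
  refine lt_of_le_of_lt (cs.length_wordProd_le _) ?_
  rw [List.length_eraseIdx_of_lt hp]
  omega

theorem neg_of_length_lt (cs : CoxeterSystem M W) [Finite W] (x : W) (j : B)
    (hx : ∀ k, 0 ≤ rho cs x (al j) k) (w : W)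
    (h : cs.length (w * (x * cs.simple j * x⁻¹)) < cs.length w) :
    ∀ k, rho cs (w * x) (al j) k ≤ 0 := by
  rcases pos_or_neg cs (w * x) j with hp | hn
  · exfalso
    have := length_lt_of_neg cs x j hx (w * (x * cs.simple j * x⁻¹)) (by
      intro k
      rw [show w * (x * cs.simple j * x⁻¹) * x = (w * x) * cs.simple j by group, rho_mul_apply,
        rho_simple_al, map_neg, Pi.neg_apply]
      have := hp k
      linarith)
    rw [show w * (x * cs.simple j * x⁻¹) * (x * cs.simple j * x⁻¹) =
      w * x * (cs.simple j * cs.simple j) * x⁻¹ by group, simple_mul_simple_self] at this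
    simp at this
    simp [mul_assoc] at this h
    omega
  · exact hn

/-- A reflection is attached to a positive root. -/
theorem exists_pos (cs : CoxeterSystem M W) (t : W) (ht : cs.IsReflection t) :
    ∃ x j, t = x * cs.simple j * x⁻¹ ∧ ∀ k, 0 ≤ rho cs x (al j) k := by
  obtain ⟨x, j, rfl⟩ := ht
  rcases pos_or_neg cs x j with hp | hn
  · exact ⟨x, j, rfl, hp⟩
  · refine ⟨x * cs.simple j, j, by simp [mul_assoc], fun k => ?_⟩
    rw [rho_mul_apply, rho_simple_al, map_neg, Pi.neg_apply]
    have := hn k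
    linarith

/-- Inversion cocycle consequence. -/
theorem erase_of_cocycle (cs : CoxeterSystem M W) [Finite W] (u v t : W) (ht : cs.IsReflection t)
    (hu : cs.length (t * u) < cs.length u) (hv : ¬ cs.length (v * t) < cs.length v)
    (ω : List B) (hω : cs.wordProd ω = v * u) :
    ∃ p, p < ω.length ∧ v * (t * u) = cs.wordProd (ω.eraseIdx p) := by
  obtain ⟨x, j, rfl, hx⟩ := exists_pos cs t ht
  have hu' : ∀ k, rho cs (u⁻¹ * x) (al j) k ≤ 0 := by
    apply neg_of_length_lt cs x j hx
    rw [← cs.length_inv, ← cs.length_inv u⁻¹]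
    simpa [mul_assoc] using hu
  have hv' : ∀ k, 0 ≤ rho cs (v * x) (al j) k := by
    rcases pos_or_neg cs (v * x) j with hp | hn
    · exact hp
    · exact absurd (length_lt_of_neg cs x j hx v hn) hv
  obtain ⟨p, hp, hp'⟩ := exchange_s9 cs (u⁻¹ * x * cs.simple j) j (fun k => by
      rw [rho_mul_apply, rho_simple_al, map_neg, Pi.neg_apply]
      have := hu' k
      linarith) ω (fun k => by
      rw [hω, show v * u * (u⁻¹ * x * cs.simple j) = v * x * cs.simple j by group,
        rho_mul_apply, rho_simple_al, map_neg, Pi.neg_apply]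
      have := hv' k
      linarith)
  refine ⟨p, hp, ?_⟩
  rw [← hp', hω]
  simp [mul_assoc]

theorem rho_word_coord (cs : CoxeterSystem M W) (l : List B) (k : B) (hk : k ∉ l) (y : B → ℝ) :
    rho cs (cs.wordProd l) y k = y k := by
  induction l with
  | nil => rw [wordProd_nil, rho_one_apply]
  | cons i l ih =>
    have h1 : k ≠ i := fun h => hk (by simp [h])
    rw [wordProd_cons, rho_mul_apply, rho_simple_apply]
    simp [al, h1]
    exact ih (fun h => hk (List.mem_cons_of_mem _ h))

theorem co_zero_of_fix (cs : CoxeterSystem M W) (l : List B) (hl : l.Nodup) (y : B → ℝ)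
    (h : rho cs (cs.wordProd l) y = y) : ∀ k ∈ l, co M k y = 0 := by
  induction l with
  | nil => simp
  | cons i l ih =>
    rw [List.nodup_cons] at hl
    have h2 : rho cs (cs.wordProd l) y = y - co M i y • al i := by
      have h3 := congrArg (rho cs (cs.simple i)) h
      rw [wordProd_cons, ← rho_mul_apply, simple_mul_simple_cancel_left, rho_simple_apply] at h3
      exact h3
    have h0 : co M i y = 0 := by
      have := congrFun h2 i
      rw [rho_word_coord cs l i hl.1] at this
      simp [al] at this
      linarith
    rw [h0] at h2
    intro k hk
    rcases List.mem_cons.mp hk with rfl | hk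
    · exact h0
    · exact ih hl.2 (by simpa using h2) k hk

/-- The stabilizer of a dominant vector is parabolic. -/
theorem word_of_fix (cs : CoxeterSystem M W) [Finite W] (i : B) (y : B → ℝ)
    (h0 : ∀ k, k ≠ i → co M k y = 0) (hi : 0 < co M i y) (v : W) (hv : rho cs v y = y) :
    ∃ l : List B, cs.IsReduced l ∧ cs.wordProd l = v ∧ i ∉ l := by
  haveI := Fintype.ofFinite W
  induction hn : cs.length v using Nat.strong_induction_on generalizing v with
  | _ n ih =>
  subst hn
  by_cases hv1 : v = 1
  · exact ⟨[], by simp [CoxeterSystem.IsReduced], by simp [hv1], by simp⟩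
  obtain ⟨j, hj⟩ := cs.exists_rightDescent_of_ne_one hv1
  have hneg := neg_of_descent cs v j hj
  have hdom : ∀ k, 0 ≤ bet cs y (al k) := by
    intro k
    have h1 := co_eq cs k y
    have h2 := bet_pos cs (al k) (al_ne_zero k)
    rcases eq_or_ne k i with rfl | hk
    · nlinarith
    · rw [h0 k hk] at h1; linarith
  have hji : j ≠ i := by
    rintro rfl
    have h1 : bet cs y (rho cs v (al j)) = bet cs y (al j) := by
      rw [← bet_inv cs v y (al j), hv]
    have h2 : rho cs v (al j) = ∑ k, (rho cs v (al j) k) • al k := by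
      funext k
      simp [al, Finset.sum_apply, Pi.single_apply]
    have h3 : bet cs y (rho cs v (al j)) ≤ 0 := by
      rw [h2, map_sum]
      apply Finset.sum_nonpos
      intro k _
      rw [map_smul, smul_eq_mul]
      exact mul_nonpos_of_nonpos_of_nonneg (hneg k) (hdom k)
    have h4 := co_eq cs j y
    have h5 := bet_pos cs (al j) (al_ne_zero j)
    nlinarith [mul_pos hi h5]
  have hj' := (cs.isRightDescent_iff).mp hj
  obtain ⟨l, hl1, hl2, hl3⟩ := ih (cs.length (v * cs.simple j)) (by omega) (v * cs.simple j) (by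
    rw [rho_mul_apply, rho_simple_apply, h0 j hji, zero_smul, sub_zero, hv]) rfl
  have hprod : cs.wordProd (l ++ [j]) = v := by
    rw [wordProd_append, hl2, wordProd_singleton, simple_mul_simple_cancel_right]
  refine ⟨l ++ [j], ?_, hprod, ?_⟩
  · unfold CoxeterSystem.IsReduced
    rw [hprod, List.length_append, ← hl1.eq, hl2]
    simpa using hj'.symm
  · simp [hl3, hji.symm]

theorem exists_fix (cs : CoxeterSystem M W) (L : List W) (hL : ∀ t ∈ L, cs.IsReflection t)
    (hlen : L.length < Fintype.card B) :
    ∃ y : B → ℝ, y ≠ 0 ∧ ∀ t ∈ L, rho cs t y = y := by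
  have hg : ∀ a : Fin L.length, ∃ g : Module.Dual ℝ (B → ℝ), ∀ y, g y = 0 →
      rho cs (L.get a) y = y := by
    intro a
    obtain ⟨x, j, hxj⟩ := hL (L.get a) (L.get_mem a)
    refine ⟨(co M j).comp (rho cs x⁻¹).toLinearMap, fun y hy => ?_⟩
    have hy' : co M j (rho cs x⁻¹ y) = 0 := hy
    rw [hxj, rho_mul_apply, rho_mul_apply, rho_simple_apply, hy', zero_smul, sub_zero,
      ← rho_mul_apply, mul_inv_cancel, rho_one_apply]
  choose g hg using hg
  let G : (B → ℝ) →ₗ[ℝ] (Fin L.length → ℝ) := LinearMap.pi g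
  have hker : LinearMap.ker G ≠ ⊥ := LinearMap.ker_ne_bot_of_finrank_lt (by simpa using hlen)
  obtain ⟨y, hy, hy0⟩ := (Submodule.ne_bot_iff _).mp hker
  refine ⟨y, hy0, fun t ht => ?_⟩
  obtain ⟨a, rfl⟩ := List.get_of_mem ht
  exact hg a y (congrFun (LinearMap.mem_ker.mp hy) a)

theorem rho_prod_fix (cs : CoxeterSystem M W) (L : List W) (y : B → ℝ)
    (h : ∀ t ∈ L, rho cs t y = y) : rho cs L.prod y = y := by
  induction L with
  | nil => simp
  | cons t L ih =>
    rw [List.prod_cons, rho_mul_apply, ih (fun s hs => h s (List.mem_cons_of_mem _ hs)),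
      h t (by simp)]

theorem exists_absLength (cs : CoxeterSystem M W) (w : W) :
    ∃ L : List W, (∀ t ∈ L, cs.IsReflection t) ∧ L.length = absLength cs w ∧ L.prod = w := by
  have hne : {k | ∃ l : List W, (∀ t ∈ l, cs.IsReflection t) ∧ l.length = k ∧
      l.prod = w}.Nonempty := by
    obtain ⟨ω, rfl⟩ := cs.wordProd_surjective w
    refine ⟨ω.length, ω.map cs.simple, ?_, by simp, rfl⟩
    intro t ht
    obtain ⟨i, -, rfl⟩ := List.mem_map.mp ht
    exact cs.isReflection_simple i
  exact Nat.sInf_mem hne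

theorem absLength_wordProd_le_s9 (cs : CoxeterSystem M W) (ω : List B) :
    absLength cs (cs.wordProd ω) ≤ ω.length := by
  apply Nat.sInf_le
  refine ⟨ω.map cs.simple, ?_, by simp, rfl⟩
  intro t ht
  obtain ⟨i, -, rfl⟩ := List.mem_map.mp ht
  exact cs.isReflection_simple i

/-- Elements below a parabolic Coxeter element lie in the parabolic subgroup. -/
theorem word_of_factor (cs : CoxeterSystem M W) [Finite W] (l : List B) (hl : l.Nodup) (i : B)
    (hl' : ∀ k, k ≠ i → k ∈ l) (v x : W) (hvx : v * x = cs.wordProd l)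
    (hlen : absLength cs v + absLength cs x < Fintype.card B) :
    ∃ ω : List B, cs.IsReduced ω ∧ cs.wordProd ω = v ∧ i ∉ ω := by
  haveI := Fintype.ofFinite W
  obtain ⟨L1, h1, h1', h1''⟩ := exists_absLength cs v
  obtain ⟨L2, h2, h2', h2''⟩ := exists_absLength cs x
  obtain ⟨y, hy0, hy⟩ := exists_fix cs (L1 ++ L2) (by
    intro t ht
    rcases List.mem_append.mp ht with h | h
    · exact h1 t h
    · exact h2 t h) (by rw [List.length_append, h1', h2']; exact hlen)
  have hv : rho cs v y = y := by
    rw [← h1'']; exact rho_prod_fix cs L1 y (fun t ht => hy t (List.mem_append_left _ ht))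
  have hx : rho cs x y = y := by
    rw [← h2'']; exact rho_prod_fix cs L2 y (fun t ht => hy t (List.mem_append_right _ ht))
  have hc : rho cs (cs.wordProd l) y = y := by rw [← hvx, rho_mul_apply, hx, hv]
  have h0 := co_zero_of_fix cs l hl y hc
  have hi : co M i y ≠ 0 := by
    intro hi
    have hall : ∀ k, bet cs y (al k) = 0 := by
      intro k
      have hk : co M k y = 0 := by
        rcases eq_or_ne k i with rfl | hk
        · exact hi
        · exact h0 k (hl' k hk)
      have := co_eq cs k y
      rw [hk] at this
      linarith
    have h2 : y = ∑ k, y k • al k := by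
      funext k
      simp [al, Finset.sum_apply, Pi.single_apply]
    have := bet_pos cs y hy0
    rw [h2, map_sum, ← h2] at this
    simp [hall] at this
  rcases lt_or_gt_of_ne hi with hneg | hpos
  · exact word_of_fix cs i (-y) (fun k hk => by rw [map_neg, h0 k (hl' k hk), neg_zero])
      (by rw [map_neg]; linarith) v (by rw [map_neg, hv])
  · exact word_of_fix cs i y (fun k hk => h0 k (hl' k hk)) hpos v hv

end Rep

theorem length_lt_of_bruhatLt {B W : Type*} [Group W] {M : CoxeterMatrix B}
    (cs : CoxeterSystem M W) (a b : W) (h : BruhatLt cs a b) : cs.length a < cs.length b := by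
  induction h with
  | single h => exact h.2
  | tail _ h ih => exact ih.trans h.2

/-- Proposition 3.3 (ii): for a cover `v ⋖ w` in `NC(W,c)` with `v` of full support,
if `K(v) >_B K(w)` then `v >_B w`. -/
theorem stmt9 [Finite W] (cs : CoxeterSystem M W) (c : W)
    (hc : IsStdCoxeterElement cs c) (v w : W)
    (hv : AbsLe cs v c) (hw : AbsLe cs w c)
    (hcov : AbsCovBy cs v w) (hfull : supp cs v = Set.univ)
    (hK : BruhatLt cs (w⁻¹ * c) (v⁻¹ * c)) :
    BruhatLt cs w v := by
  classical
  obtain ⟨l, hnd, hmem, hl⟩ := hc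
  haveI : Fintype B := ⟨l.toFinset, fun i => by simp [hmem i]⟩
  have hcard : Fintype.card B = l.length := by
    rw [← List.toFinset_card_of_nodup hnd, ← Finset.card_univ]
    congr 1
    ext i
    simp [hmem i]
  have hKl := length_lt_of_bruhatLt cs _ _ hK
  obtain ⟨ht, hcov2⟩ := hcov
  have hinv : w⁻¹ * v = v⁻¹ * w := by
    have := ht.inv
    simpa using this
  have hwc : w⁻¹ * c = (v⁻¹ * w) * (v⁻¹ * c) := by
    rw [← hinv]; group
  apply Relation.TransGen.single
  refine ⟨by rw [hinv]; exact ht, ?_⟩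
  by_contra hcon
  have hvt : v * (v⁻¹ * w) = w := by group
  obtain ⟨p, hp, hp'⟩ := erase_of_cocycle cs (v⁻¹ * c) v (v⁻¹ * w) ht (by rw [← hwc]; exact hKl)
    (by rw [hvt]; exact hcon) l (by rw [hl]; group)
  rw [← hwc] at hp'
  have hcl := absLength_wordProd_le_s9 cs l
  rw [hl] at hcl
  unfold AbsLe at hw
  obtain ⟨ω, hω1, hω2, hω3⟩ := word_of_factor cs (l.eraseIdx p) (hnd.eraseIdx p) l[p]
    (fun k hk => by
      obtain ⟨q, hq, rfl⟩ := List.getElem_of_mem (hmem k)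
      rw [List.mem_eraseIdx_iff_getElem]
      refine ⟨q, hq, ?_, rfl⟩
      rintro rfl
      exact hk rfl) v (w⁻¹ * c) hp' (by omega)
  have : l[p] ∈ supp cs v := by rw [hfull]; trivial
  exact hω3 (this ω hω1 hω2)

end NCpaper
end
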